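/- Suppose δ < ε. Then every point of Q2 is a convex combination of points of S*, i.e., Q2 ⊆ conv(S*). -/

import Mathlib

open Finset

/-- A convex set containing the four corners of a vertical trapezoid contains the trapezoid. -/
theorem Convex.trapezoid_mem {C : Set (ℝ × ℝ)} (hC : Convex ℝ C) {a b A B r f : ℝ}
    (hab : a < b) (ha₀ : (a, 0) ∈ C) (ha : (a, A) ∈ C) (hb₀ : (b, 0) ∈ C) (hb : (b, B) ∈ C)
    (har : a ≤ r) (hrb : r ≤ b) (hf : 0 ≤ f)
    (hfle : (b - a) * f ≤ A * (b - r) + B * (r - a)) : (r, f) ∈ C := by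
  have hd : 0 < b - a := sub_pos.2 hab
  have hw₁ : 0 ≤ (b - r) / (b - a) := div_nonneg (sub_nonneg.2 hrb) hd.le
  have hw₂ : 0 ≤ (r - a) / (b - a) := div_nonneg (sub_nonneg.2 har) hd.le
  have hw : (b - r) / (b - a) + (r - a) / (b - a) = 1 := by field_simp; ring
  have hbot : (r, (0 : ℝ)) ∈ C := by
    convert hC ha₀ hb₀ hw₁ hw₂ hw using 1
    ext
    · simp; field_simp; ring
    · simp
  have htop : (r, (A * (b - r) + B * (r - a)) / (b - a)) ∈ C := by
    convert hC ha hb hw₁ hw₂ hw using 1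
    ext
    · simp; field_simp; ring
    · simp; field_simp
  have hfL : f ≤ (A * (b - r) + B * (r - a)) / (b - a) := by
    rw [le_div_iff₀ hd]; linarith
  generalize (A * (b - r) + B * (r - a)) / (b - a) = L at htop hfL
  rcases hf.eq_or_lt with rfl | hf'
  · exact hbot
  have hL : 0 < L := hf'.trans_le hfL
  convert hC hbot htop (sub_nonneg.2 ((div_le_one hL).2 hfL)) (div_nonneg hf hL.le)
    (sub_add_cancel 1 (f / L)) using 1
  ext
  · simp; ring
  · simp; field_simp

theorem stmt_5
    (n : ℕ) (hn : 0 < n)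
    (γ υ : ℝ) (hυ : 0 < υ) (hγυ : υ < γ)
    (O : Set ℝ)
    (hO : O = {r : ℝ | ∃ k : ℕ, k ≤ 2 ^ (n - 1) ∧ r = (k : ℝ) * 2 ^ ((1 : ℤ) - (n : ℤ))})
    (Sstar : Set (ℝ × ℝ))
    (hS : Sstar = {p : ℝ × ℝ | p.1 ∈ O ∧ 0 ≤ p.2 ∧ p.2 ≤ γ ∧ p.2 * p.1 ≤ υ})
    (μm μp : ℝ)
    (hμm : μm = 2 ^ ((1 : ℤ) - (n : ℤ)) * (⌊υ / (2 ^ ((1 : ℤ) - (n : ℤ)) * γ)⌋ : ℝ))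
    (hμp : μp = μm + 2 ^ ((1 : ℤ) - (n : ℤ)))
    (δ ε : ℝ)
    (hδ : δ = (γ - υ) / (μm - 1))
    (hε : ε = (γ - υ / μp) / (μm - μp))
    (Q2 : Set (ℝ × ℝ))
    (hQ2 : Q2 = {p : ℝ × ℝ | 0 ≤ p.1 ∧ p.1 ≤ 1 ∧ 0 ≤ p.2 ∧ p.2 ≤ γ ∧
      p.2 ≤ ε * (p.1 - μm) + γ ∧ p.2 ≤ ((υ / μp - υ) / (μp - 1)) * (p.1 - 1) + υ})
    (hcase : δ < ε)
    :
    Q2 ⊆ convexHull ℝ Sstar := by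
  subst hO hS hQ2
  have hh : (0 : ℝ) < 2 ^ ((1 : ℤ) - (n : ℤ)) := by positivity
  have hhN : ((2 ^ (n - 1) : ℕ) : ℝ) * 2 ^ ((1 : ℤ) - (n : ℤ)) = 1 := by
    have hn' : (1 : ℤ) - (n : ℤ) = -((n - 1 : ℕ) : ℤ) := by omega
    rw [hn', zpow_neg, zpow_natCast]
    push_cast
    exact mul_inv_cancel₀ (by positivity)
  generalize (2 : ℝ) ^ ((1 : ℤ) - (n : ℤ)) = h at *
  generalize 2 ^ (n - 1) = N at *
  have hγ : 0 < γ := hυ.trans hγυ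
  have hhγ : 0 < h * γ := mul_pos hh hγ
  obtain ⟨m, hm⟩ : ∃ m : ℕ, ⌊υ / (h * γ)⌋ = (m : ℤ) :=
    Int.eq_ofNat_of_zero_le (Int.floor_nonneg.2 (by positivity))
  have hmle : (m : ℝ) * (h * γ) ≤ υ := by
    have := Int.floor_le (υ / (h * γ))
    rwa [hm, le_div_iff₀ hhγ, Int.cast_natCast] at this
  have hmlt : υ < (m + 1 : ℝ) * (h * γ) := by
    have := Int.lt_floor_add_one (υ / (h * γ))
    rwa [hm, div_lt_iff₀ hhγ, Int.cast_natCast] at this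
  rw [hm, Int.cast_natCast] at hμm
  have hμm0 : 0 ≤ μm := by rw [hμm]; positivity
  have hμp0 : 0 < μp := by linarith
  have hμmγ : γ * μm ≤ υ := by rw [hμm]; linarith
  have hμpγ : υ < γ * μp := by rw [hμp, hμm]; linarith
  have hmN : m < N := by
    have h₁ : (m : ℝ) * (h * γ) < N * (h * γ) := by
      calc (m : ℝ) * (h * γ) ≤ υ := hmle
        _ < γ := hγυ
        _ = N * (h * γ) := by rw [← mul_assoc, hhN, one_mul]
    exact_mod_cast lt_of_mul_lt_mul_right h₁ hhγ.le
  have hμp_eq : μp = ((m + 1 : ℕ) : ℝ) * h := by rw [hμp, hμm]; push_cast; ring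
  have hμp1 : μp < 1 := by
    refine lt_of_le_of_ne ?_ ?_
    · rw [hμp_eq, ← hhN]
      gcongr
      exact hmN
    · intro h₁
      rw [hδ, hε, h₁, div_one] at hcase
      exact hcase.false
  have hmp : μm < μp := by linarith
  set S : Set (ℝ × ℝ) := {p : ℝ × ℝ | p.1 ∈ {r : ℝ | ∃ k : ℕ, k ≤ N ∧ r = (k : ℝ) * h} ∧
    0 ≤ p.2 ∧ p.2 ≤ γ ∧ p.2 * p.1 ≤ υ} with hS
  have hmem : ∀ (k : ℕ) (r f : ℝ), k ≤ N → r = k * h → 0 ≤ f → f ≤ γ → f * r ≤ υ →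
      (r, f) ∈ convexHull ℝ S := fun k r f hk hr h₀ h₁ h₂ =>
    subset_convexHull ℝ S ⟨⟨k, hk, hr⟩, h₀, h₁, h₂⟩
  have hυμp : υ / μp ≤ γ := by rw [div_le_iff₀ hμp0]; exact hμpγ.le
  have hμm_eq : μm = m * h := by rw [hμm, mul_comm]
  have h00 := hmem 0 0 0 (Nat.zero_le _) (by simp) le_rfl hγ.le (by simpa using hυ.le)
  have h0γ := hmem 0 0 γ (Nat.zero_le _) (by simp) hγ.le le_rfl (by simpa using hυ.le)
  have hm0 := hmem m μm 0 hmN.le hμm_eq le_rfl hγ.le (by simpa using hυ.le)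
  have hmγ := hmem m μm γ hmN.le hμm_eq hγ.le le_rfl hμmγ
  have hp0 := hmem (m + 1) μp 0 hmN hμp_eq le_rfl hγ.le (by simpa using hυ.le)
  have hpυ := hmem (m + 1) μp (υ / μp) hmN hμp_eq (by positivity) hυμp
    (div_mul_cancel₀ _ hμp0.ne').le
  have h10 := hmem N 1 0 le_rfl hhN.symm le_rfl hγ.le (by simpa using hυ.le)
  have h1υ := hmem N 1 υ le_rfl hhN.symm hυ.le hγυ.le (mul_one υ).le
  have hconv := convex_convexHull ℝ S
  rintro ⟨r, f⟩ ⟨hr0, hr1, hf0, hfγ, hf₁, hf₂⟩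
  dsimp only at hr0 hr1 hf0 hfγ hf₁ hf₂
  rcases lt_or_ge r μm with hrm | hrm
  · refine hconv.trapezoid_mem (hr0.trans_lt hrm) h00 h0γ hm0 hmγ hr0 hrm.le hf0 ?_
    have := mul_le_mul_of_nonneg_left hfγ hμm0
    linarith
  rcases le_total r μp with hrp | hrp
  · refine hconv.trapezoid_mem hmp hm0 hmγ hp0 hpυ hrm hrp hf0 ?_
    have h₁ := mul_le_mul_of_nonneg_left hf₁ (sub_pos.2 hmp).le
    have h₂ : (μp - μm) * ε = υ / μp - γ := by
      have : μm - μp ≠ 0 := (sub_neg.2 hmp).ne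
      linear_combination (μp - μm) * hε - div_mul_cancel₀ (γ - υ / μp) this
    linear_combination h₁ + (r - μm) * h₂
  · refine hconv.trapezoid_mem hμp1 hp0 hpυ h10 h1υ hrp hr1 hf0 ?_
    have h₁ := mul_le_mul_of_nonneg_left hf₂ (sub_pos.2 hμp1).le
    have h₂ := div_mul_cancel₀ (υ / μp - υ) (sub_neg.2 hμp1).ne
    linear_combination h₁ - (r - 1) * h₂
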